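/- arXiv:2407.10770 — 3 statements merged into one kernel-verified Lean document; each statement's English description precedes it below -/
import Mathlib

section
/- Let E be a finite-dimensional real inner-product space, Y ⊆ E a convex set, and G : E → ℝ^q a map each of whose q real components is convex on Y. Let (y^k)_{k≥0} be a sequence in Y and define q^0 := max{−G(y^0), 0} and q^{k+1} := max{−G(y^{k+1}), q^k + G(y^{k+1})} for k ≥ 0 (componentwise maxima). Then for every k ≥ 1, writing ȳ^k := (1/k) Σ_{ℓ=1}^k y^ℓ, one has G(ȳ^k) ≤ q^k / k componentwise. -/
open Finset

/-- Virtual-queue bound on the running average: if every component of `G` is convex on a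
convex set `Y`, `(y^k) ⊆ Y`, and `q^0 = max{−G(y^0), 0}`,
`q^{k+1} = max{−G(y^{k+1}), q^k + G(y^{k+1})}` componentwise, then for `k ≥ 1` the running
average `ȳ^k = (1/k) Σ_{ℓ=1}^k y^ℓ` satisfies `G(ȳ^k) ≤ q^k / k` componentwise. -/
theorem stmt_7 {E : Type*} [NormedAddCommGroup E] [InnerProductSpace ℝ E]
    [FiniteDimensional ℝ E]
    (Y : Set E) (hY : Convex ℝ Y) (q : ℕ)
    (G : E → EuclideanSpace ℝ (Fin q))
    (hGconv : ∀ ℓ : Fin q, ConvexOn ℝ Y (fun z => G z ℓ))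
    (y : ℕ → E) (hy : ∀ k, y k ∈ Y)
    (Q : ℕ → EuclideanSpace ℝ (Fin q))
    (hQ0 : ∀ ℓ, Q 0 ℓ = max (-(G (y 0) ℓ)) 0)
    (hQ : ∀ k ℓ, Q (k + 1) ℓ = max (-(G (y (k + 1)) ℓ)) (Q k ℓ + G (y (k + 1)) ℓ)) :
    ∀ k : ℕ, 1 ≤ k → ∀ ℓ : Fin q,
      G ((k : ℝ)⁻¹ • ∑ j ∈ Finset.Icc 1 k, y j) ℓ ≤ Q k ℓ / k := by
  intro k hk ℓ
  have hsum : ∀ n : ℕ, ∑ j ∈ Finset.Icc 1 n, G (y j) ℓ ≤ Q n ℓ := by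
    intro n
    induction n with
    | zero => simp [hQ0]
    | succ n ih =>
      rw [Finset.sum_Icc_succ_top (by omega), hQ]
      exact le_max_of_le_right (by linarith)
  have hk0 : (0 : ℝ) < k := by exact_mod_cast hk
  have hjensen := (hGconv ℓ).map_sum_le (t := Finset.Icc 1 k) (w := fun _ => (k : ℝ)⁻¹) (p := y)
    (fun _ _ => by positivity) (by simp [hk0.ne']) (fun j _ => hy j)
  simp only [← Finset.smul_sum] at hjensen
  refine hjensen.trans ?_
  rw [smul_eq_mul, div_eq_inv_mul]
  exact mul_le_mul_of_nonneg_left (hsum k) (by positivity)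
end

section
/- Let E and F₀ be finite-dimensional real inner-product spaces, n ∈ ℕ with n ≥ 1, F := F₀^n, and let S : F → F₀ be the block-sum map S(u) := Σ_{i=1}^n u_i. Let W, H : F → F be linear maps satisfying S(Wu) = S(u) and S(Hu) = 0 for all u ∈ F. Let B : E → F be linear, c ∈ F, and ρ > 0. Let (y^k)_{k≥1} be an arbitrary sequence in E, let u^0 ∈ F, set z^0 := ρ H u^0, and for k ≥ 0 define u^{k+1} := W u^k + (1/ρ)(B y^{k+1} − c − z^k) and z^{k+1} := z^k + ρ H u^{k+1}. Then for every k ≥ 1, writing ȳ^k := (1/k) Σ_{ℓ=1}^k y^ℓ, one has S(B ȳ^k − c) = (ρ/k) S(u^k − u^0). -/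
open Finset

/-- Telescoping identity for the dual updates: with `S(u) = Σ_i u_i`, `S∘W = S`, `S∘H = 0`,
`z^0 = ρ H u^0`, `u^{k+1} = W u^k + (1/ρ)(B y^{k+1} − c − z^k)`, and
`z^{k+1} = z^k + ρ H u^{k+1}`, one has `S(B ȳ^k − c) = (ρ/k) S(u^k − u^0)` for all `k ≥ 1`,
where `ȳ^k = (1/k) Σ_{ℓ=1}^k y^ℓ`. -/
theorem stmt_8 {E F₀ : Type*}
    [NormedAddCommGroup E] [InnerProductSpace ℝ E] [FiniteDimensional ℝ E]
    [NormedAddCommGroup F₀] [InnerProductSpace ℝ F₀] [FiniteDimensional ℝ F₀]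
    (n : ℕ) (hn : 1 ≤ n)
    (W H : (Fin n → F₀) →ₗ[ℝ] (Fin n → F₀))
    (hW : ∀ u : Fin n → F₀, ∑ i, W u i = ∑ i, u i)
    (hH : ∀ u : Fin n → F₀, ∑ i, H u i = 0)
    (B : E →ₗ[ℝ] (Fin n → F₀)) (c : Fin n → F₀) (ρ : ℝ) (hρ : 0 < ρ)
    (y : ℕ → E) (u z : ℕ → Fin n → F₀)
    (hz0 : z 0 = ρ • H (u 0))
    (hu : ∀ k, u (k + 1) = W (u k) + ρ⁻¹ • (B (y (k + 1)) - c - z k))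
    (hz : ∀ k, z (k + 1) = z k + ρ • H (u (k + 1))) :
    ∀ k : ℕ, 1 ≤ k →
      ∑ i, (B ((k : ℝ)⁻¹ • ∑ j ∈ Finset.Icc 1 k, y j) - c) i =
        (ρ / k) • ∑ i, (u k - u 0) i := by
  let S : (Fin n → F₀) →ₗ[ℝ] F₀ := ∑ i, LinearMap.proj i
  have hS (v : Fin n → F₀) : ∑ i, v i = S v := by simp [S]
  simp only [hS] at hW hH ⊢
  have hSz (k : ℕ) : S (z k) = 0 := by
    induction k with
    | zero => rw [hz0, map_smul, hH, smul_zero]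
    | succ k ih => rw [hz, map_add, map_smul, hH, ih, smul_zero, add_zero]
  have step (k : ℕ) : ρ • (S (u (k + 1)) - S (u k)) = S (B (y (k + 1))) - S c := by
    rw [hu, map_add, hW, add_sub_cancel_left, map_smul, smul_inv_smul₀ hρ.ne', map_sub, map_sub,
      hSz, sub_zero]
  have telescope (k : ℕ) :
      S (B (∑ j ∈ Finset.Icc 1 k, y j)) - (k : ℝ) • S c = ρ • S (u k - u 0) := by
    induction k with
    | zero => simp
    | succ k ih =>
      have h := step k
      rw [map_sub] at ih ⊢
      rw [Finset.sum_Icc_succ_top (by omega), map_add, map_add, Nat.cast_succ, add_smul, one_smul,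
        add_sub_add_comm, ih, ← h, ← smul_add, add_comm, sub_add_sub_cancel]
  intro k hk
  have hk0 : (k : ℝ) ≠ 0 := by positivity
  rw [div_eq_inv_mul, mul_smul, ← telescope, smul_sub, inv_smul_smul₀ hk0, map_sub, map_smul,
    map_smul]
end

section
/- Let D, R, a, L ≥ 0 be reals with √(L²a²/4 + D + L√R) + La/2 > 0, and set γ̃ := ( √(L²a²/4 + D + L√R) + La/2 )^{−2}. Then for all reals γ and C with 0 < γ ≤ γ̃ and 0 ≤ C ≤ R + a²/(2γ), one has γ·(D + L√C) ≤ 1. -/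
/-- The algebraic fact underlying the step-size selection: if
`γ̃ := (√(L²a²/4 + D + L√R) + La/2)⁻²` and `0 < γ ≤ γ̃`, then for any `C` with
`0 ≤ C ≤ R + a²/(2γ)` one has `γ(D + L√C) ≤ 1`. -/
theorem stmt_16 (D R a L : ℝ) (hD : 0 ≤ D) (hR : 0 ≤ R) (ha : 0 ≤ a) (hL : 0 ≤ L)
    (hpos : 0 < Real.sqrt (L ^ 2 * a ^ 2 / 4 + D + L * Real.sqrt R) + L * a / 2)
    (γtilde : ℝ)
    (hγt : γtilde = (Real.sqrt (L ^ 2 * a ^ 2 / 4 + D + L * Real.sqrt R) + L * a / 2) ^ (-2 : ℤ))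
    (γ C : ℝ) (hγ0 : 0 < γ) (hγ : γ ≤ γtilde) (hC0 : 0 ≤ C) (hC : C ≤ R + a ^ 2 / (2 * γ)) :
    γ * (D + L * Real.sqrt C) ≤ 1 := by
  set K := D + L * Real.sqrt R with hK
  have hK0 : 0 ≤ K := by positivity
  set S := Real.sqrt (L ^ 2 * a ^ 2 / 4 + D + L * Real.sqrt R) with hS
  have hS0 : 0 ≤ S := Real.sqrt_nonneg _
  have hS2 : S ^ 2 = L ^ 2 * a ^ 2 / 4 + K := by
    rw [hS, Real.sq_sqrt (by positivity), hK]
    ring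
  obtain ⟨s, hs, rfl⟩ : ∃ s : ℝ, 0 < s ∧ γ = s ^ 2 :=
    ⟨Real.sqrt γ, Real.sqrt_pos.2 hγ0, (Real.sq_sqrt hγ0.le).symm⟩
  have hsS : s * (S + L * a / 2) ≤ 1 := by
    have h : s ^ 2 * (S + L * a / 2) ^ 2 ≤ 1 := by
      rw [hγt, zpow_neg, ← one_div, le_div_iff₀ (by positivity)] at hγ
      exact_mod_cast hγ
    rw [← mul_pow] at h
    exact (sq_le_one_iff₀ (by positivity)).1 h
  have hsqrt : Real.sqrt C ≤ Real.sqrt R + a / s := by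
    refine Real.sqrt_le_iff.2 ⟨by positivity, hC.trans ?_⟩
    have h1 : a ^ 2 / (2 * s ^ 2) ≤ (a / s) ^ 2 := by
      rw [div_pow]
      gcongr
      nlinarith [sq_nonneg s]
    have h2 : 0 ≤ Real.sqrt R * (a / s) := by positivity
    nlinarith [Real.sq_sqrt hR]
  have hquad : s ^ 2 * K + L * a * s ≤ 1 := by
    have h := pow_le_pow_left₀ (mul_nonneg hs.le hS0)
      (show s * S ≤ 1 - L * a * s / 2 by linarith) 2
    rw [mul_pow, hS2] at h
    linarith
  calc s ^ 2 * (D + L * Real.sqrt C)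
      ≤ s ^ 2 * (D + L * (Real.sqrt R + a / s)) := by gcongr
    _ = s ^ 2 * K + L * a * s := by
      rw [hK]
      field_simp
      ring
    _ ≤ 1 := hquad
end
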